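/- arXiv:1909.12139 — 2 statements merged into one kernel-verified Lean document; each statement's English description precedes it below -/
import Mathlib

section
/- log p_k^(k) = k(log k + log log k + O(log log log k)) as k → ∞; that is, there exists a constant C > 0 and K such that for all k ≥ K one has |log p_k^(k) − k(log k + log log k)| ≤ C·k·log log log k. -/
open Real Filter

/-- `nthPrime n` is the `n`-th prime number, 1-indexed: `nthPrime 1 = 2`, `nthPrime 2 = 3`, … -/
noncomputable def nthPrime (n : ℕ) : ℕ := Nat.nth Nat.Prime (n - 1)

/-- `iterPrime n k` is the `k`-fold iterated prime `p_n^(k)`: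
`iterPrime n 0 = n`, `iterPrime n 1 = p_n`, and `iterPrime n (k+1) = p_{iterPrime n k}`. -/
noncomputable def iterPrime (n : ℕ) : ℕ → ℕ
  | 0 => n
  | k + 1 => nthPrime (iterPrime n k)

lemma log_le_two_mul_sqrt {x : ℝ} (hx : 0 < x) : log x ≤ 2 * √x := by
  have := log_le_self (sqrt_nonneg x)
  rw [log_sqrt hx.le] at this
  linarith

lemma lt_nthPrime {n : ℕ} (hn : 1 ≤ n) : n < nthPrime n := by
  have := Nat.add_two_le_nth_prime (n - 1)
  unfold nthPrime
  lia

lemma primeCounting_nthPrime {n : ℕ} (hn : 1 ≤ n) : Nat.primeCounting (nthPrime n) = n := by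
  have h : Nat.primeCounting (nthPrime n) = Nat.primeCounting' (nthPrime n) + 1 := by
    simp [Nat.primeCounting, Nat.primeCounting', Nat.count_succ, nthPrime]
  rw [h, nthPrime, Nat.primeCounting'_nth_eq]
  lia

lemma tendsto_nthPrime : Tendsto nthPrime atTop atTop :=
  tendsto_atTop_mono' _ ((eventually_ge_atTop 1).mono fun _ hn => (lt_nthPrime hn).le) tendsto_id

/-- Chebyshev's lower bound `π(x) ≥ x / (2 log x)`, multiplied out. -/
lemma eventually_le_primeCounting_mul_log :
    ∀ᶠ n : ℕ in atTop, (n : ℝ) ≤ 2 * Nat.primeCounting n * log n := by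
  have h1 : ∀ᶠ n : ℕ in atTop, log (n : ℝ) ≤ 0.05 * n := by
    have := (isLittleO_log_id_atTop.bound (show (0 : ℝ) < 0.05 by norm_num))
    filter_upwards [tendsto_natCast_atTop_atTop.eventually this] with n hn
    simpa using (le_abs_self _).trans hn
  filter_upwards [h1, eventually_ge_atTop 100] with n hn hn'
  have h100 : (100 : ℝ) ≤ n := by exact_mod_cast hn'
  have hlog : 0 < log (n : ℝ) := log_pos (by linarith)
  have h := Chebyshev.pi_ge n
  rw [div_le_iff₀ hlog] at h
  have h2 : log ((n : ℝ) + 1) ≤ log n + log 2 := by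
    rw [← log_mul (by positivity) (by norm_num)]
    exact log_le_log (by positivity) (by linarith)
  have := log_two_gt_d9
  have := log_two_lt_d9
  nlinarith

/-- Chebyshev's upper bound `π(x) ≤ 2 x / log x`, multiplied out. -/
lemma eventually_primeCounting_mul_log_le :
    ∀ᶠ n : ℕ in atTop, Nat.primeCounting n * log n ≤ 2 * (n : ℝ) := by
  have h := Chebyshev.eventually_primeCounting_le (show (0 : ℝ) < 0.5 by norm_num)
  filter_upwards [tendsto_natCast_atTop_atTop.eventually h, eventually_ge_atTop 2] with n hn hn'
  have h2 : (2 : ℝ) ≤ n := by exact_mod_cast hn'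
  have hlog : 0 < log (n : ℝ) := log_pos (by linarith)
  rw [Nat.floor_natCast, le_div_iff₀ hlog] at hn
  have h4 : log 4 = 2 * log 2 := by
    rw [show (4 : ℝ) = 2 ^ 2 by norm_num, log_pow]; norm_num
  have := log_two_lt_d9
  nlinarith

lemma eventually_le_log_nthPrime :
    ∀ᶠ n : ℕ in atTop, log n + log (log n) - log 8 ≤ log (nthPrime n) := by
  filter_upwards [tendsto_nthPrime.eventually eventually_primeCounting_mul_log_le,
    eventually_ge_atTop 2] with n hn hn'
  rw [primeCounting_nthPrime (by lia)] at hn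
  have h2 : (2 : ℝ) ≤ n := by exact_mod_cast hn'
  have hlog : 0 < log (n : ℝ) := log_pos (by linarith)
  have hp : (n : ℝ) ≤ nthPrime n := by exact_mod_cast (lt_nthPrime (by lia)).le
  have hl : log (n : ℝ) ≤ log (nthPrime n) := log_le_log (by linarith) hp
  rw [← log_mul (by positivity) (by positivity), ← log_div (by positivity) (by norm_num)]
  refine log_le_log (by positivity) ?_
  rw [div_le_iff₀ (by norm_num)]
  nlinarith

lemma eventually_log_nthPrime_le :
    ∀ᶠ n : ℕ in atTop, log (nthPrime n) ≤ log n + log (log n) + log 8 := by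
  filter_upwards [tendsto_nthPrime.eventually eventually_le_primeCounting_mul_log,
    eventually_ge_atTop 4] with n hn hn'
  rw [primeCounting_nthPrime (by lia)] at hn
  have h4 : (4 : ℝ) ≤ n := by exact_mod_cast hn'
  have hlog : 0 < log (n : ℝ) := log_pos (by linarith)
  have hp : (n : ℝ) ≤ nthPrime n := by exact_mod_cast (lt_nthPrime (by lia)).le
  set p : ℝ := ((nthPrime n : ℕ) : ℝ)
  have hp0 : 0 < p := by linarith
  have hs : √p ≤ 4 * n := by
    have h1 := log_le_two_mul_sqrt hp0
    have h2 := mul_self_sqrt hp0.le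
    have h3 := sqrt_pos.2 hp0
    by_contra! h
    nlinarith
  have hl : log p ≤ 4 * log n := by
    have h1 : p ≤ (n : ℝ) ^ 4 := by
      rw [sqrt_le_left (by positivity)] at hs
      nlinarith [mul_nonneg (sq_nonneg (n : ℝ)) (show (0 : ℝ) ≤ n ^ 2 - 16 by nlinarith)]
    have h2 := log_le_log hp0 h1
    rw [log_pow] at h2
    exact_mod_cast h2
  rw [← log_mul (by positivity) (by positivity), ← log_mul (by positivity) (by norm_num)]
  refine log_le_log hp0 ?_
  nlinarith

section Recursion

variable {L : ℕ → ℝ} {B : ℝ}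

/-- Self-bounding: `X ≤ k (log X + B)` forces `X ≤ k (log k + log log k + O(1))`. -/
lemma le_of_le_mul_log_add {X k : ℝ} (hB : 0 ≤ B) (hX : 1 ≤ X) (hk : (B + 4) ^ 2 ≤ k)
    (hBk : B ≤ log k) (h : X ≤ k * (log X + B)) : X ≤ k * (log k + log (log k) + log 4 + B) := by
  have hk1 : 1 < k := by nlinarith
  have hlk : 0 < log k := log_pos hk1
  have hBk' : 2 * log (B + 4) ≤ log k := by
    have := log_le_log (by positivity) hk
    rwa [log_pow] at this
  have hs1 : 1 ≤ √X := one_le_sqrt.2 hX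
  have hsX : √X ≤ k * (B + 4) := by
    have h1 := log_le_two_mul_sqrt (show 0 < X by linarith)
    have h2 := mul_self_sqrt (show 0 ≤ X by linarith)
    have h3 : √X * √X ≤ k * (B + 4) * √X := by
      rw [h2]
      refine h.trans ?_
      rw [mul_assoc]
      gcongr
      nlinarith
    exact le_of_mul_le_mul_right h3 (by linarith)
  have hlX : log X ≤ 3 * log k := by
    have h1 := log_le_log (by linarith) hsX
    rw [log_sqrt (by linarith), log_mul (by positivity) (by positivity)] at h1
    linarith
  have hX4 : X ≤ k * (log k * 4) := h.trans (by gcongr; linarith)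
  have hl4 : log X ≤ log k + (log (log k) + log 4) := by
    rw [← log_mul (by positivity) (by norm_num), ← log_mul (by positivity) (by positivity)]
    exact log_le_log (by linarith) hX4
  refine h.trans ?_
  gcongr
  linarith

lemma le_of_forall_le_add_log (hL : Monotone L) (h0 : 0 < L 0)
    (h : ∀ j, L (j + 1) ≤ L j + log (L j) + B) (k : ℕ) :
    L k ≤ L 0 + k * (log (L k) + B) := by
  have : ∀ j ≤ k, L j ≤ L 0 + j * (log (L k) + B) := by
    intro j
    induction j with
    | zero => simp
    | succ j ih =>
      intro hj
      have h1 := ih (by lia)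
      have h2 : log (L j) ≤ log (L k) :=
        log_le_log (h0.trans_le (hL (Nat.zero_le j))) (hL (by lia))
      push_cast
      linarith [h j]
  exact this k le_rfl

lemma add_one_le_of_forall_add_log_le (hB : 0 ≤ B) (h0 : exp (B + 1) ≤ L 0)
    (h : ∀ j, L j + log (L j) - B ≤ L (j + 1)) (j : ℕ) : (j : ℝ) + 1 ≤ L j := by
  have h1 : 1 ≤ exp (B + 1) := one_le_exp (by linarith)
  have : exp (B + 1) + j ≤ L j := by
    induction j with
    | zero => simpa
    | succ j ih =>
      have h2 : exp (B + 1) ≤ L j := by linarith [Nat.cast_nonneg (α := ℝ) j]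
      have h3 := (le_log_iff_exp_le (by linarith)).2 h2
      push_cast
      linarith [h j]
  linarith

lemma mul_log_sub_le_log_factorial (n : ℕ) : n * log n - n ≤ log n.factorial := by
  rcases Nat.eq_zero_or_pos n with rfl | hn
  · simp
  have h1 := Stirling.le_log_factorial_stirling hn.ne'
  have h2 : 0 ≤ log (n : ℝ) := log_natCast_nonneg n
  have h3 : 0 ≤ log (2 * π) := log_nonneg (by linarith [pi_gt_three])
  linarith

lemma log_factorial_succ (n : ℕ) :
    log (n + 1).factorial = log n.factorial + log (n + 1 : ℝ) := by
  rw [Nat.factorial_succ, Nat.cast_mul, log_mul (by positivity) (by positivity)]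
  push_cast
  ring

lemma log_factorial_sub_le (hB : 0 ≤ B) (h0 : exp (B + 1) ≤ L 0)
    (h : ∀ j, L j + log (L j) - B ≤ L (j + 1)) (j : ℕ) : log j.factorial - B * j ≤ L j := by
  induction j with
  | zero => simpa using (exp_pos _).le.trans h0
  | succ j ih =>
    have h1 := log_le_log (by positivity) (add_one_le_of_forall_add_log_le hB h0 h j)
    rw [log_factorial_succ]
    push_cast
    linarith [h j]

lemma half_mul_log_le (hB : 0 ≤ B) (h0 : exp (B + 1) ≤ L 0)
    (h : ∀ j, L j + log (L j) - B ≤ L (j + 1)) {j : ℕ} (hj : 2 * (B + 1) ≤ log j) :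
    j * log j / 2 ≤ L j := by
  have h1 := mul_log_sub_le_log_factorial j
  have h2 := log_factorial_sub_le hB h0 h j
  nlinarith [Nat.cast_nonneg (α := ℝ) j]

/-- The first `m ≥ √k` steps only contribute `log j!`, all later ones an additional
`log log k + O(1)` each. -/
lemma log_factorial_add_sub_le (hB : 0 ≤ B) (h0 : exp (B + 1) ≤ L 0)
    (h : ∀ j, L j + log (L j) - B ≤ L (j + 1)) {k m : ℕ} (hk : 4 * (B + 1) ≤ log k)
    (hm : √k ≤ m) (i : ℕ) :
    log (m + i).factorial + i * (log (log k) - log 8) - B * (m + i) ≤ L (m + i) := by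
  induction i with
  | zero => simpa using log_factorial_sub_le hB h0 h m
  | succ i ih =>
    have hlk : 0 < log (k : ℝ) := by linarith
    have hk0 : (0 : ℝ) < k := by
      rcases Nat.eq_zero_or_pos k with rfl | h
      · simp at hlk
      · exact_mod_cast h
    have hmi : √k ≤ ((m + i : ℕ) : ℝ) := by push_cast; linarith [Nat.cast_nonneg (α := ℝ) i]
    have hl : log k / 2 ≤ log ((m + i : ℕ) : ℝ) := by
      rw [← log_sqrt hk0.le]
      exact log_le_log (sqrt_pos.2 hk0) hmi
    have h1 := half_mul_log_le hB h0 h (j := m + i) (by linarith)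
    have hpos : (1 : ℝ) ≤ ((m + i : ℕ) : ℝ) := by
      have : (0 : ℝ) < ((m + i : ℕ) : ℝ) := (sqrt_pos.2 hk0).trans_le hmi
      exact_mod_cast this
    have h2 : (((m + i : ℕ) : ℝ) + 1) * (log k / 8) ≤ L (m + i) := by
      nlinarith
    have h3 := log_le_log (by positivity) h2
    rw [log_mul (by positivity) (by positivity), log_div (by positivity) (by norm_num)] at h3
    have h4 := h (m + i)
    rw [← add_assoc, log_factorial_succ]
    push_cast at *
    linarith

lemma le_of_forall_add_log_le (hB : 0 ≤ B) (h0 : exp (B + 1) ≤ L 0)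
    (h : ∀ j, L j + log (L j) - B ≤ L (j + 1)) {k : ℕ} (hk : 4 * (B + 1) ≤ log k) :
    k * (log k + log (log k)) - (B + 5 + log 8) * k ≤ L k := by
  have hlk : 1 ≤ log (k : ℝ) := by linarith
  have hk1 : (1 : ℝ) ≤ k := by
    rcases Nat.eq_zero_or_pos k with rfl | h
    · simp at hlk; linarith
    · exact_mod_cast h
  have hm1 : ⌈√(k : ℝ)⌉₊ ≤ k := Nat.ceil_le.2 ((sqrt_le_left (by linarith)).2 (by nlinarith))
  have hm2 := Nat.le_ceil √(k : ℝ)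
  have hm3 := Nat.ceil_lt_add_one (sqrt_nonneg (k : ℝ))
  have h1 := log_factorial_add_sub_le hB h0 h hk hm2 (k - ⌈√(k : ℝ)⌉₊)
  rw [Nat.cast_sub hm1, Nat.add_sub_cancel' hm1] at h1
  have h2 := mul_log_sub_le_log_factorial k
  have hs1 : 1 ≤ √(k : ℝ) := one_le_sqrt.2 hk1
  have hs2 := mul_self_sqrt (show (0 : ℝ) ≤ k by linarith)
  have hll : log (log k) ≤ 2 * √k :=
    (log_le_self (by linarith)).trans (log_le_two_mul_sqrt (by linarith))
  have hll0 : 0 ≤ log (log k) := log_nonneg hlk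
  have h8 : 0 ≤ log 8 := log_nonneg (by norm_num)
  set m : ℝ := ((⌈√(k : ℝ)⌉₊ : ℕ) : ℝ)
  have h3 : m * log (log k) ≤ 4 * k := by
    calc m * log (log k) ≤ (2 * √k) * (2 * √k) := by gcongr; linarith
      _ = 4 * k := by linarith
  nlinarith [mul_nonneg (show 0 ≤ m by positivity) h8]

end Recursion

lemma iterPrime_lt_succ {n : ℕ} (hn : 1 ≤ n) (j : ℕ) : iterPrime n j < iterPrime n (j + 1) := by
  refine lt_nthPrime ?_
  induction j with
  | zero => exact hn
  | succ j ih => exact ih.trans (lt_nthPrime ih).le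

theorem log_iterPrime_diag_asymptotic :
    ∃ C : ℝ, C > 0 ∧ ∃ K : ℕ, ∀ k : ℕ, K ≤ k →
      |Real.log (iterPrime k k) - k * (Real.log k + Real.log (Real.log k))| ≤
        C * k * Real.log (Real.log (Real.log k)) := by
  have h8 : 0 ≤ log 8 := log_nonneg (by norm_num)
  have h4 : log 4 ≤ log 8 := log_le_log (by norm_num) (by norm_num)
  refine ⟨2 * log 8 + 5, by linarith, ?_⟩
  obtain ⟨N, hN⟩ := eventually_atTop.1
    (eventually_le_log_nthPrime.and eventually_log_nthPrime_le)
  have hlog : Tendsto (fun k : ℕ => log (k : ℝ)) atTop atTop :=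
    tendsto_log_atTop.comp tendsto_natCast_atTop_atTop
  have hlll : Tendsto (fun k : ℕ => log (log (log (k : ℝ)))) atTop atTop :=
    tendsto_log_atTop.comp (tendsto_log_atTop.comp hlog)
  refine eventually_atTop.1 ?_
  filter_upwards [eventually_ge_atTop N, eventually_ge_atTop 1,
    hlog.eventually_ge_atTop (exp (log 8 + 1)), hlog.eventually_ge_atTop (4 * (log 8 + 1)),
    hlll.eventually_ge_atTop 1,
    tendsto_natCast_atTop_atTop.eventually_ge_atTop ((log 8 + 1 + 4) ^ 2)]
    with k hkN hk1 hk2 hk3 hk4 hk5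
  have hmono : Monotone (iterPrime k) :=
    monotone_nat_of_le_succ fun j => (iterPrime_lt_succ hk1 j).le
  have hge (j : ℕ) : k ≤ iterPrime k j := hmono (Nat.zero_le j)
  have hk0 : (1 : ℝ) ≤ k := by exact_mod_cast hk1
  have hLmono : Monotone fun j => log (iterPrime k j : ℝ) := fun i j hij =>
    log_le_log (by exact_mod_cast hk1.trans (hge i)) (by exact_mod_cast hmono hij)
  have hlow := le_of_forall_add_log_le (L := fun j => log (iterPrime k j : ℝ)) h8 hk2
    (fun j => (hN _ (hkN.trans (hge j))).1) hk3
  have hup := le_of_forall_le_add_log hLmono (show 0 < log (k : ℝ) by linarith)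
    (fun j => (hN _ (hkN.trans (hge j))).2) k
  have hk6 : log (k : ℝ) ≤ log (iterPrime k k : ℝ) := hLmono (Nat.zero_le k)
  have hlk : log (k : ℝ) ≤ k := log_le_self (by linarith)
  have hup' := le_of_le_mul_log_add (B := log 8 + 1) (k := k)
    (X := log (iterPrime k k : ℝ)) (by linarith) (by linarith) hk5 (by linarith) (by
      refine hup.trans ?_
      change log (k : ℝ) + _ ≤ _
      linarith)
  have hC : (2 * log 8 + 5) * k * 1 ≤ (2 * log 8 + 5) * k * log (log (log k)) := by gcongr
  rw [abs_le]
  constructor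
  · linarith
  · nlinarith
end

section
/- For every fixed natural number n ≥ 1, P_n^T(x) ∼ log x / log log x as x → ∞; that is, P_n^T(x) · log log x / log x tends to 1 as x → ∞. -/
open Real Filter

/-- The counting function `P_n^T(x) = #{k ≥ 1 : p_n^(k) ≤ x}`. -/
noncomputable def PnT (n : ℕ) (x : ℝ) : ℕ :=
  {k : ℕ | 1 ≤ k ∧ (iterPrime n k : ℝ) ≤ x}.ncard

/-- The counting function `DiagP(x) = #{k ≥ 1 : p_k^(k) ≤ x}`. -/
noncomputable def DiagP (x : ℝ) : ℕ :=
  {k : ℕ | 1 ≤ k ∧ (iterPrime k k : ℝ) ≤ x}.ncard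

open Topology

theorem succ_le_nthPrime {m : ℕ} (hm : 1 ≤ m) : m + 1 ≤ nthPrime m := by
  have := Nat.add_two_le_nth_prime (m - 1)
  unfold nthPrime
  omega

theorem primeCounting_nthPrime_s11 {m : ℕ} (hm : 1 ≤ m) : Nat.primeCounting (nthPrime m) = m := by
  have h : Nat.count Nat.Prime (Nat.nth Nat.Prime (m - 1) + 1) = m - 1 + 1 :=
    Nat.count_nth_succ fun hf => absurd hf Nat.infinite_setOfPred_prime
  rw [Nat.primeCounting_eq_primeCounting'_succ]
  unfold nthPrime Nat.primeCounting'
  omega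

theorem one_le_iterPrime {n : ℕ} (hn : 1 ≤ n) (k : ℕ) : 1 ≤ iterPrime n k := by
  induction k with
  | zero => exact hn
  | succ k ih => exact (Nat.le_succ_of_le ih).trans (succ_le_nthPrime ih)

theorem iterPrime_strictMono {n : ℕ} (hn : 1 ≤ n) : StrictMono (iterPrime n) :=
  strictMono_nat_of_lt_succ fun k => succ_le_nthPrime (one_le_iterPrime hn k)

theorem eventually_div_four_mul_log_le_primeCounting :
    ∀ᶠ x : ℝ in atTop, x / (4 * log x) ≤ Nat.primeCounting ⌊x⌋₊ := by
  have h : ∀ᶠ x : ℝ in atTop, log (x + 2) ≤ 1 / 10 * (x + 2) := by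
    have h1 := (isLittleO_log_id_atTop.bound (show (0 : ℝ) < 1 / 10 by norm_num))
    filter_upwards [(tendsto_atTop_add_const_right atTop (2 : ℝ) tendsto_id).eventually h1,
      eventually_ge_atTop 0] with x hx hx0
    simp only [id, norm_eq_abs] at hx
    rw [abs_of_nonneg (by linarith : (0 : ℝ) ≤ x + 2)] at hx
    exact (le_abs_self _).trans hx
  filter_upwards [h, eventually_ge_atTop 100] with x hx hx100
  refine le_trans ?_ (Chebyshev.pi_ge' (by linarith : 1 < x))
  have hlog : 0 < log x := log_pos (by linarith)
  rw [← div_div]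
  gcongr
  nlinarith [log_two_gt_d9]

/-- Chebyshev's bounds in logarithmic form: `log x - log π(x) ∼ log log x`. -/
theorem tendsto_log_sub_log_primeCounting_div_log_log :
    Tendsto (fun x : ℝ => (log x - log (Nat.primeCounting ⌊x⌋₊)) / log (log x))
      atTop (𝓝 1) := by
  have hll : Tendsto (fun x : ℝ => log (log x)) atTop atTop :=
    tendsto_log_atTop.comp tendsto_log_atTop
  have hconst (c : ℝ) : Tendsto (fun x : ℝ => 1 + c / log (log x)) atTop (𝓝 1) := by
    simpa using (hll.const_div_atTop c).const_add 1
  have hC : 0 < log 4 + 1 := by positivity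
  refine tendsto_of_tendsto_of_tendsto_of_le_of_le' (hconst (-log (log 4 + 1)))
    (hconst (log 4)) ?_ ?_
  · filter_upwards [Chebyshev.eventually_primeCounting_le one_pos,
      eventually_div_four_mul_log_le_primeCounting, eventually_gt_atTop 1,
      hll.eventually_gt_atTop 0] with x hx hx' hx1 hl
    have hlog : 0 < log x := log_pos hx1
    have hpi : (0 : ℝ) < Nat.primeCounting ⌊x⌋₊ := lt_of_lt_of_le (by positivity) hx'
    have h := log_le_log hpi hx
    rw [log_div (by positivity) hlog.ne', log_mul hC.ne' (by positivity)] at h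
    rw [le_div_iff₀ hl]
    field_simp
    linarith
  · filter_upwards [eventually_div_four_mul_log_le_primeCounting, eventually_gt_atTop 1,
      hll.eventually_gt_atTop 0] with x hx hx1 hl
    have hlog : 0 < log x := log_pos hx1
    have h := log_le_log (by positivity) hx
    rw [log_div (by positivity) (by positivity), log_mul (by norm_num) hlog.ne'] at h
    rw [div_le_iff₀ hl]
    field_simp
    linarith

theorem tendsto_sub_div_log {L : ℕ → ℝ} (hmono : Monotone L) (hL : Tendsto L atTop atTop)
    (h : Tendsto (fun k => (L (k + 1) - L k) / log (L (k + 1))) atTop (𝓝 1)) :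
    Tendsto (fun k => L (k + 1) / log (L (k + 1)) - L k / log (L k)) atTop (𝓝 1) := by
  have hlog : Tendsto (fun k => log (L k)) atTop atTop := tendsto_log_atTop.comp hL
  have hlow : Tendsto (fun k => (L (k + 1) - L k) / log (L (k + 1)) -
      (L (k + 1) - L k) / log (L (k + 1)) / log (L k)) atTop (𝓝 1) := by
    simpa using h.sub (h.div_atTop hlog)
  refine tendsto_of_tendsto_of_tendsto_of_le_of_le' hlow h ?_ ?_
  all_goals
    filter_upwards [hL.eventually_gt_atTop 1] with k hk
    have hle : L k ≤ L (k + 1) := hmono k.le_succ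
    have h0 : 0 < log (L k) := log_pos hk
    have hll : log (L k) ≤ log (L (k + 1)) := log_le_log (by linarith) hle
    have h1 : 0 < log (L (k + 1)) := h0.trans_le hll
  · have hd : L k * (log (L (k + 1)) - log (L k)) ≤ L (k + 1) - L k := by
      have := log_le_sub_one_of_pos (show 0 < L (k + 1) / L k by apply div_pos <;> linarith)
      rw [log_div (by linarith) (by linarith), div_sub_one (by linarith),
        le_div_iff₀ (by linarith)] at this
      linarith
    have : L (k + 1) / log (L (k + 1)) - L k / log (L k) =
        (L (k + 1) - L k) / log (L (k + 1)) -
          L k * (log (L (k + 1)) - log (L k)) / log (L (k + 1)) / log (L k) := by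
      field_simp
      ring
    rw [this]
    gcongr
  · rw [sub_div]
    gcongr

theorem tendsto_div_log_div_nat {L : ℕ → ℝ} (hmono : Monotone L) (hL : Tendsto L atTop atTop)
    (h : Tendsto (fun k => (L (k + 1) - L k) / log (L (k + 1))) atTop (𝓝 1)) :
    Tendsto (fun k : ℕ => L k / log (L k) / k) atTop (𝓝 1) := by
  have hc := (tendsto_sub_div_log hmono hL h).cesaro
  have hz : Tendsto (fun k : ℕ => L 0 / log (L 0) / (k : ℝ)) atTop (𝓝 0) :=
    tendsto_natCast_atTop_atTop.const_div_atTop _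
  have := hc.add hz
  rw [add_zero] at this
  refine this.congr fun k => ?_
  rw [Finset.sum_range_sub (fun k => L k / log (L k))]
  ring

theorem tendsto_log_iterPrime {n : ℕ} (hn : 1 ≤ n) :
    Tendsto (fun k => log (iterPrime n k)) atTop atTop :=
  tendsto_log_atTop.comp
    (tendsto_natCast_atTop_atTop.comp (iterPrime_strictMono hn).tendsto_atTop)

theorem tendsto_log_iterPrime_div {n : ℕ} (hn : 1 ≤ n) :
    Tendsto (fun k : ℕ => log (iterPrime n k) / log (log (iterPrime n k)) / k)
      atTop (𝓝 1) := by
  refine tendsto_div_log_div_nat (L := fun k => log (iterPrime n k)) ?_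
    (tendsto_log_iterPrime hn) ?_
  · intro i j hij
    have := one_le_iterPrime hn i
    have := (iterPrime_strictMono hn).monotone hij
    dsimp only
    gcongr
  · have := tendsto_log_sub_log_primeCounting_div_log_log.comp
      (tendsto_natCast_atTop_atTop.comp
        ((iterPrime_strictMono hn).tendsto_atTop.comp (tendsto_add_atTop_nat 1)))
    refine this.congr fun k => ?_
    have hpi : Nat.primeCounting (iterPrime n (k + 1)) = iterPrime n k :=
      primeCounting_nthPrime_s11 (one_le_iterPrime hn k)
    simp [hpi]

theorem le_PnT_iff {n : ℕ} (hn : 1 ≤ n) {x : ℝ} (hx : n ≤ x) (k : ℕ) :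
    k ≤ PnT n x ↔ (iterPrime n k : ℝ) ≤ x := by
  have hmono := iterPrime_strictMono hn
  have hex : ∃ k, x < iterPrime n k :=
    ((tendsto_natCast_atTop_atTop.comp hmono.tendsto_atTop).eventually_gt_atTop x).exists
  classical
  have hiff (j : ℕ) : (iterPrime n j : ℝ) ≤ x ↔ j < Nat.find hex := by
    rw [Nat.lt_find_iff]
    refine ⟨fun h i hi => not_lt.2 (le_trans ?_ h), fun h => not_lt.1 (h j le_rfl)⟩
    exact_mod_cast hmono.monotone hi
  have hpos : 0 < Nat.find hex := (hiff 0).1 hx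
  have hset : {k : ℕ | 1 ≤ k ∧ (iterPrime n k : ℝ) ≤ x} = Finset.Ico 1 (Nat.find hex) := by
    ext j
    rw [Set.mem_ofPred_eq, hiff, Finset.mem_coe, Finset.mem_Ico]
  have hcard : PnT n x = Nat.find hex - 1 := by
    rw [PnT, hset, Set.ncard_coe_finset, Nat.card_Ico]
  rw [hiff, hcard]
  omega

theorem tendsto_PnT_atTop {n : ℕ} (hn : 1 ≤ n) : Tendsto (PnT n) atTop atTop := by
  refine tendsto_atTop.2 fun k => ?_
  filter_upwards [eventually_ge_atTop (n : ℝ), eventually_ge_atTop (iterPrime n k : ℝ)]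
    with x hx hk using (le_PnT_iff hn hx k).2 hk

theorem div_log_monotoneOn : MonotoneOn (fun u : ℝ => u / log u) (Set.Ici (exp 1)) := by
  intro u hu v hv huv
  have hpos : 0 < log v / v :=
    div_pos (log_pos ((one_lt_exp_iff.2 one_pos).trans_le hv)) ((exp_pos 1).trans_le hv)
  simpa using inv_anti₀ hpos (log_div_self_antitoneOn hu hv huv)

theorem PnT_asymp (n : ℕ) (hn : 1 ≤ n) :
    Filter.Tendsto (fun x : ℝ => (PnT n x : ℝ) * Real.log (Real.log x) / Real.log x)
      Filter.atTop (nhds 1) := by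
  have hN := tendsto_PnT_atTop hn
  have hlow := (tendsto_log_iterPrime_div hn).comp hN
  have hratio : Tendsto (fun k : ℕ => ((k + 1 : ℕ) : ℝ) / k) atTop (𝓝 1) := by
    have : Tendsto (fun k : ℕ => 1 + 1 / (k : ℝ)) atTop (𝓝 (1 + 0)) :=
      (tendsto_natCast_atTop_atTop.const_div_atTop 1).const_add 1
    rw [add_zero] at this
    refine this.congr' ?_
    filter_upwards [eventually_gt_atTop 0] with k hk
    have hk' : (k : ℝ) ≠ 0 := by positivity
    rw [Nat.cast_add_one, add_div, div_self hk']
  have hup : Tendsto (fun k : ℕ => log (iterPrime n (k + 1)) /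
      log (log (iterPrime n (k + 1))) / k) atTop (𝓝 1) := by
    have := ((tendsto_log_iterPrime_div hn).comp (tendsto_add_atTop_nat 1)).mul hratio
    rw [one_mul] at this
    refine this.congr fun k => ?_
    simp only [Function.comp_apply]
    rw [div_mul_div_cancel₀ (by positivity)]
  have hmain : Tendsto (fun x : ℝ => log x / log (log x) / PnT n x) atTop (𝓝 1) := by
    have hL := (tendsto_log_iterPrime hn).comp hN
    refine tendsto_of_tendsto_of_tendsto_of_le_of_le' hlow (hup.comp hN) ?_ ?_
    all_goals
      filter_upwards [hL.eventually_ge_atTop (exp 1), eventually_ge_atTop (n : ℝ)] with x hLx hx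
      have hpos : (0 : ℝ) < iterPrime n (PnT n x) := by
        exact_mod_cast one_le_iterPrime hn _
      have hle := (le_PnT_iff hn hx (PnT n x)).1 le_rfl
      have hlog : log (iterPrime n (PnT n x)) ≤ log x := log_le_log hpos hle
      simp only [Function.comp_apply] at hLx ⊢
      refine div_le_div_of_nonneg_right ?_ (Nat.cast_nonneg _)
    · exact div_log_monotoneOn hLx (hLx.trans hlog) hlog
    · have hlt : x < iterPrime n (PnT n x + 1) :=
        not_le.1 fun h => absurd ((le_PnT_iff hn hx _).2 h) (by omega)
      have hlog' : log x ≤ log (iterPrime n (PnT n x + 1)) :=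
        log_le_log (hpos.trans_le hle) hlt.le
      exact div_log_monotoneOn (hLx.trans hlog) ((hLx.trans hlog).trans hlog') hlog'
  have := hmain.inv₀ one_ne_zero
  rw [inv_one] at this
  refine this.congr fun x => ?_
  rw [inv_div, div_div_eq_mul_div]
end
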